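/- arXiv:1309.2998 — 2 statements merged into one kernel-verified Lean document; each statement's English description precedes it below -/
import Mathlib

section
/- There exist fields ℚ ⊆ K ⊆ L ⊆ \overline{ℚ} such that K/ℚ is an infinite algebraic extension, K does not satisfy the Bogomolov property (B), the extension L/K is finite with [L:K] > 1, and L/K is Bogomolov. -/
open NumberField IntermediateField
open scoped Classical

noncomputable section

namespace RelBogomolov

/-- The "denominator ideal" of an element `x` of a field `K`: the ideal of integers `a` of `K`
such that `a * x` is an algebraic integer.  For a number field `K`, the logarithm of its absolute
norm is the finite (non-archimedean) part `∑_{v finite} log max (1, |x|_v)` of the Weil height. -/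
def denomIdeal (K : Type*) [Field K] (x : K) : Ideal (𝓞 K) where
  carrier := {a | IsIntegral ℤ ((a : K) * x)}
  add_mem' := by
    intro a b ha hb
    have := ha.add hb
    simpa [add_mul] using this
  zero_mem' := by
    simpa using isIntegral_zero
  smul_mem' := by
    intro c a ha
    have hc : IsIntegral ℤ (c : K) := RingOfIntegers.isIntegral_coe c
    simpa [smul_eq_mul, mul_assoc] using hc.mul ha

/-- The absolute logarithmic Weil height of an element of a number field `K`:
`h(x) = (1/[K:ℚ]) (∑_{v archimedean} [K_v : ℚ_v] log max (1, |x|_v)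
          + ∑_{v finite} [K_v : ℚ_v] log max (1, |x|_v))`,
where the finite part is expressed as the log of the absolute norm of the denominator ideal. -/
def nfHeight (K : Type*) [Field K] [NumberField K] (x : K) : ℝ :=
  (Module.finrank ℚ K : ℝ)⁻¹ *
    ((∑ w : InfinitePlace K, (w.mult : ℝ) * Real.log (max 1 (w x))) +
      Real.log (Ideal.absNorm (denomIdeal K x)))

/-- The absolute logarithmic Weil height of a complex number that is algebraic over `ℚ`,
computed in the number field `ℚ(x)` (junk value `0` for transcendental numbers). -/
def algHeight (x : ℂ) : ℝ :=
  if hx : IsIntegral ℚ x then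
    letI : FiniteDimensional ℚ ℚ⟮x⟯ := adjoin.finiteDimensional hx
    haveI : CharZero ℚ⟮x⟯ := charZero_of_injective_algebraMap (algebraMap ℚ ℚ⟮x⟯).injective
    haveI : NumberField ℚ⟮x⟯ := ⟨⟩
    nfHeight ℚ⟮x⟯ (AdjoinSimple.gen ℚ x)
  else 0

/-- The multiplicative Weil height `H(x) = exp h(x)`. -/
def mulHeight (x : ℂ) : ℝ := Real.exp (algHeight x)

/-- A fixed algebraic closure of `ℚ`: the field of algebraic numbers inside `ℂ`. -/
def Qbar : IntermediateField ℚ ℂ := _root_.algebraicClosure ℚ ℂ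

/-- A subfield `K` of `ℚ̄` has the Bogomolov property (B) if there is `ε > 0` such that no
nonzero element of `K` has height strictly between `0` and `ε`. -/
def HasBogomolovProperty (K : IntermediateField ℚ ℂ) : Prop :=
  ∃ ε : ℝ, 0 < ε ∧ ∀ x : ℂ, x ∈ K → x ≠ 0 → ¬(0 < algHeight x ∧ algHeight x < ε)

/-- The extension `L/K` is Bogomolov if there is `ε > 0` such that every nonzero `x ∈ L`
with `0 < h(x) < ε` lies in `K`. -/
def IsBogomolovExtension (K L : IntermediateField ℚ ℂ) : Prop :=
  ∃ ε : ℝ, 0 < ε ∧ ∀ x : ℂ, x ∈ L → x ≠ 0 → 0 < algHeight x → algHeight x < ε → x ∈ K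

/-- `δ(M)`: the number of archimedean places of `M` (junk value `0` in the infinite case). -/
def archPlaces (M : IntermediateField ℚ ℂ) : ℕ :=
  if h : FiniteDimensional ℚ ↥M then
    letI := h
    haveI : CharZero ↥M := charZero_of_injective_algebraMap (algebraMap ℚ ↥M).injective
    haveI : NumberField ↥M := ⟨⟩
    Fintype.card (InfinitePlace ↥M)
  else 0

/-- The absolute norm `N_{F/ℚ}` of an ideal of the ring of integers of a subfield `F ⊆ ℚ̄`
(junk value `0` in the infinite case). -/
def idealNorm {F : IntermediateField ℚ ℂ} (I : Ideal (𝓞 ↥F)) : ℕ :=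
  if h : FiniteDimensional ℚ ↥F then
    letI := h
    haveI : CharZero ↥F := charZero_of_injective_algebraMap (algebraMap ℚ ↥F).injective
    haveI : NumberField ↥F := ⟨⟩
    Ideal.absNorm I
  else 0

/-- The relative discriminant ideal `D_{F'/F}` of an extension of number fields, defined as
the ideal of `𝓞 F` generated by the discriminants of all `[F':F]`-tuples of integers of `F'`. -/
def relDiscrNF (F F' : Type*) [Field F] [Field F'] [Algebra F F'] : Ideal (𝓞 F) :=
  Ideal.span {d : 𝓞 F | ∃ x : Fin (Module.finrank F F') → 𝓞 F', d = Algebra.discr (𝓞 F) x}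

/-- The relative discriminant ideal `D_{C/F}` for subfields `F ≤ C` of `ℚ̄`
(junk value `⊥` if `F ≰ C`). -/
def relDiscr (F C : IntermediateField ℚ ℂ) : Ideal (𝓞 ↥F) :=
  if h : F ≤ C then
    letI : Algebra ↥F ↥C := (IntermediateField.inclusion h).toAlgebra
    relDiscrNF ↥F ↥C
  else ⊥

/-- The inclusion `𝓞 F →+* 𝓞 M` of rings of integers induced by an inclusion `F ≤ M` of
subfields of `ℚ̄`. -/
def intInclusion {F M : IntermediateField ℚ ℂ} (h : F ≤ M) : 𝓞 ↥F →+* 𝓞 ↥M :=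
  RingOfIntegers.mapRingHom (IntermediateField.inclusion h)

/-- `ρ(K/F)`: the least real number `ρ` such that every finite subextension `M` of `K/F` is
contained in a finite subextension `M'` of `K/F` with `δ(M')/[M':F] ≤ ρ`. -/
def rho (F K : IntermediateField ℚ ℂ) : ℝ :=
  sInf {r : ℝ | ∀ M : IntermediateField ℚ ℂ, F ≤ M → M ≤ K → FiniteDimensional ℚ ↥M →
    ∃ M' : IntermediateField ℚ ℂ, M ≤ M' ∧ M' ≤ K ∧ FiniteDimensional ℚ ↥M' ∧
      (archPlaces M' : ℝ) / (relfinrank F M' : ℝ) ≤ r}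

/-- The norm excess discriminant `E(K, C/F)`: the infimum over finite subextensions `M` of
`K/F` (with `e = [M:F]`, `s = [C:F]`) of
`N_{F/ℚ}(D_{C/F}^e / gcd(D_{C/F}^e, D_{M/F}^s))^{1/e}`; here the gcd of two ideals is their
sup, and the norm of the quotient ideal is the quotient of the norms. -/
def normExcess (K F C : IntermediateField ℚ ℂ) : ℝ :=
  sInf {r : ℝ | ∃ M : IntermediateField ℚ ℂ, F ≤ M ∧ M ≤ K ∧ FiniteDimensional ℚ ↥M ∧
    r = ((idealNorm ((relDiscr F C) ^ (relfinrank F M)) : ℝ) /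
          (idealNorm ((relDiscr F C) ^ (relfinrank F M) ⊔ (relDiscr F M) ^ (relfinrank F C)) : ℝ))
        ^ ((relfinrank F M : ℝ)⁻¹)}

/-- `a(𝔭)`: the greatest `k` such that `x^ℓ ≡ α (mod 𝔭^k)` has a solution `x ∈ 𝓞 F`. -/
def aExp (F : Type*) [Field F] (ℓ : ℕ) (α : 𝓞 F) (𝔭 : Ideal (𝓞 F)) : ℕ :=
  sSup {k : ℕ | ∃ x : 𝓞 F, x ^ ℓ - α ∈ 𝔭 ^ k}

end RelBogomolov

open RelBogomolov

namespace RelBogomolov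

open IsDedekindDomain Polynomial

/-- Writing `x = α / β` with integral `α`, `β`, the denominator ideal is `(β) / (α, β)`. -/
lemma denomIdeal_mul_span (K : Type*) [Field K] [NumberField K] {x : K} {α β : 𝓞 K}
    (hβ : β ≠ 0) (hx : x = α / β) :
    denomIdeal K x * Ideal.span {α, β} = Ideal.span {β} := by
  have hβ' : (β : K) ≠ 0 := by simpa using hβ
  set J : Ideal (𝓞 K) := Ideal.span {α, β} with hJ
  have hJ0 : J ≠ ⊥ := by
    intro h
    have : β ∈ J := Ideal.subset_span (by simp)
    rw [h] at this
    exact hβ (by simpa using this)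
  have hle : Ideal.span {β} ≤ J := Ideal.span_mono (by simp)
  obtain ⟨I, hI⟩ := Ideal.dvd_iff_le.mpr hle
  suffices denomIdeal K x = I by rw [this, hI, mul_comm]
  ext a
  have h1 : a ∈ denomIdeal K x ↔ a * α ∈ Ideal.span {β} := by
    change IsIntegral ℤ ((a : K) * x) ↔ _
    rw [Ideal.mem_span_singleton']
    constructor
    · intro h
      obtain ⟨c, hc⟩ : ∃ c : 𝓞 K, algebraMap (𝓞 K) K c = a * x := ⟨⟨_, h⟩, rfl⟩
      refine ⟨c, ?_⟩
      apply RingOfIntegers.coe_injective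
      rw [map_mul, map_mul, hc, hx]
      field_simp
    · rintro ⟨c, hc⟩
      have hc' : (c : K) * β = a * α := by exact_mod_cast congrArg (fun z : 𝓞 K ↦ (z : K)) hc
      have : (a : K) * x = c := by
        rw [hx]; field_simp; rw [← hc', mul_comm]
      rw [this]
      exact RingOfIntegers.isIntegral_coe c
  have h2 : a * α ∈ Ideal.span {β} ↔ Ideal.span {a} * J ≤ Ideal.span {β} := by
    rw [hJ, Ideal.span_mul_span', Ideal.span_le]
    constructor
    · intro h
      rintro _ ⟨b, hb, c, hc, rfl⟩
      simp only [Set.mem_singleton_iff] at hb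
      subst hb
      rcases hc with rfl | hc
      · exact h
      · simp only [Set.mem_singleton_iff] at hc
        subst hc
        exact Ideal.mul_mem_left _ _ (Ideal.mem_span_singleton_self _)
    · intro h
      exact h ⟨a, rfl, α, by simp, rfl⟩
  rw [h1, h2, hI, mul_comm, ← Ideal.dvd_iff_le, mul_dvd_mul_iff_left (by exact hJ0),
    Ideal.dvd_iff_le, Ideal.span_singleton_le_iff_mem]

lemma exists_integral_div {K : Type*} [Field K] (x : K) [NumberField K] :
    ∃ α β : 𝓞 K, β ≠ 0 ∧ x = α / β := by
  obtain ⟨a, b, hb, rfl⟩ := IsFractionRing.div_surjective (𝓞 K) x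
  exact ⟨a, b, nonZeroDivisors.ne_zero hb, rfl⟩

lemma hasFiniteMulSupport_max_one {K : Type*} [Field K] [NumberField K] (x : K) :
    (fun v : FinitePlace K ↦ max (v x) 1).HasFiniteMulSupport := by
  by_cases h0 : x = 0
  · simpa [h0] using! Function.hasFiniteMulSupport_one
  · exact (FinitePlace.hasFiniteMulSupport h0).max Function.hasFiniteMulSupport_one

lemma absNorm_denomIdeal (K : Type*) [Field K] [NumberField K] (x : K) :
    (Ideal.absNorm (denomIdeal K x) : ℝ) = ∏ᶠ v : FinitePlace K, max (v x) 1 := by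
  obtain ⟨α, β, hβ, hx⟩ := exists_integral_div x
  have hβ' : (β : K) ≠ 0 := by simpa using hβ
  have h1 := congrArg (fun I ↦ (Ideal.absNorm I : ℝ)) (denomIdeal_mul_span K hβ hx)
  simp only [map_mul, Nat.cast_mul, Ideal.absNorm_span_singleton] at h1
  have hne : (![α, β] : Fin 2 → 𝓞 K) ≠ 0 := fun h ↦ hβ (by simpa using congrFun h 1)
  have h2 := absNorm_mul_finprod_finitePlace_eq_one hne
  rw [Matrix.range_cons, Matrix.range_cons, Matrix.range_empty, Set.union_empty,
    Set.singleton_union] at h2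
  have h3 := FinitePlace.prod_eq_inv_abs_norm_int hβ
  have h4 : ∀ v : FinitePlace K, (⨆ i, v ((![α, β] : Fin 2 → 𝓞 K) i : 𝓞 K)) =
      v β * max (v x) 1 := by
    intro v
    have hv : 0 < v β := FinitePlace.pos_iff.mpr hβ'
    rw [mul_max_of_nonneg _ _ hv.le, ← map_mul, hx, mul_div_cancel₀ _ hβ', mul_one]
    apply le_antisymm
    · refine ciSup_le fun i ↦ ?_
      fin_cases i <;> simp
    · exact max_le (le_ciSup (f := fun i ↦ v ((![α, β] : Fin 2 → 𝓞 K) i : 𝓞 K))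
        (Set.finite_range _).bddAbove 0)
        (le_ciSup (f := fun i ↦ v ((![α, β] : Fin 2 → 𝓞 K) i : 𝓞 K))
        (Set.finite_range _).bddAbove 1)
  simp_rw [h4] at h2
  rw [finprod_mul_distrib (FinitePlace.hasFiniteMulSupport hβ')
    (hasFiniteMulSupport_max_one x), h3] at h2
  have hN : ((Algebra.norm ℤ β).natAbs : ℝ) = |(Algebra.norm ℤ β : ℝ)| := by
    rw [Nat.cast_natAbs, Int.cast_abs]
  rw [hN] at h1
  have hN0 : |(Algebra.norm ℤ β : ℝ)| ≠ 0 := by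
    simpa [Algebra.norm_eq_zero_iff] using hβ
  set A := (Ideal.absNorm (Ideal.span {α, β}) : ℝ)
  have hA : A ≠ 0 := left_ne_zero_of_mul (h2 ▸ one_ne_zero)
  apply mul_right_cancel₀ hA
  rw [h1]
  field_simp at h2
  linarith

lemma nfHeight_eq_logHeight₁ (K : Type*) [Field K] [NumberField K] (x : K) :
    nfHeight K x = (Module.finrank ℚ K : ℝ)⁻¹ * Height.logHeight₁ x := by
  have hpos : ∀ w : InfinitePlace K, 0 < max (w x) 1 := fun w ↦ by positivity
  have hf : (∏ᶠ v : FinitePlace K, max (v x) 1) ≠ 0 := by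
    have : (0 : ℝ) < ∏ᶠ v : FinitePlace K, max (v x) 1 :=
      finprod_induction (0 < ·) one_pos (fun _ _ ↦ mul_pos) fun v ↦ by positivity
    exact this.ne'
  rw [nfHeight, absNorm_denomIdeal, Height.logHeight₁_eq_log_mulHeight₁, NumberField.mulHeight₁_eq,
    Real.log_mul (Finset.prod_ne_zero_iff.mpr fun w _ ↦ (pow_pos (hpos w) _).ne') hf,
    Real.log_prod fun w _ ↦ (pow_pos (hpos w) _).ne']
  simp only [Real.log_pow, max_comm]

lemma sum_infinitePlace_eq_sum_embeddings (K : Type*) [Field K] [NumberField K] (x : K)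
    (f : ℝ → ℝ) :
    ∑ w : InfinitePlace K, (w.mult : ℝ) * f (w x) = ∑ φ : K →+* ℂ, f ‖φ x‖ := by
  rw [← Finset.sum_fiberwise Finset.univ InfinitePlace.mk (fun φ : K →+* ℂ ↦ f ‖φ x‖)]
  refine Finset.sum_congr rfl fun w _ ↦ ?_
  have (φ) (hφ : φ ∈ ({φ | InfinitePlace.mk φ = w} : Finset (K →+* ℂ))) : f ‖φ x‖ = f (w x) := by
    rw [← (Finset.mem_filter.mp hφ).2, InfinitePlace.apply]
  rw [Finset.sum_congr rfl this, Finset.sum_const, InfinitePlace.card_filter_mk_eq, nsmul_eq_mul]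

lemma sum_embeddings_algebraMap (F M : Type*) [Field F] [NumberField F] [Field M] [NumberField M]
    [Algebra F M] (g : (F →+* ℂ) → ℝ) :
    ∑ φ : M →+* ℂ, g (φ.comp (algebraMap F M)) = Module.finrank F M * ∑ φ : F →+* ℂ, g φ := by
  rw [← Finset.sum_fiberwise Finset.univ (fun φ : M →+* ℂ ↦ φ.comp (algebraMap F M)),
    Finset.mul_sum]
  refine Finset.sum_congr rfl fun ψ _ ↦ ?_
  have (φ) (hφ : φ ∈ ({φ | φ.comp (algebraMap F M) = ψ} : Finset (M →+* ℂ))) :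
      g (φ.comp (algebraMap F M)) = g ψ := by
    rw [(Finset.mem_filter.mp hφ).2]
  rw [Finset.sum_congr rfl this, Finset.sum_const, nsmul_eq_mul]
  congr 2
  let _ : Algebra F ℂ := ψ.toAlgebra
  rw [← AlgHom.card F M ℂ, ← Fintype.card_subtype]
  refine Fintype.card_congr ⟨fun φ ↦ ⟨φ.1, fun r ↦ congrArg (fun h : F →+* ℂ ↦ h r) φ.2⟩,
    fun φ ↦ ⟨φ.toRingHom, RingHom.ext φ.commutes⟩, fun _ ↦ rfl, fun _ ↦ rfl⟩

lemma absNorm_denomIdeal_algebraMap (F M : Type*) [Field F] [NumberField F] [Field M]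
    [NumberField M] [Algebra F M] (x : F) :
    Ideal.absNorm (denomIdeal M (algebraMap F M x)) =
      Ideal.absNorm (denomIdeal F x) ^ Module.finrank F M := by
  obtain ⟨α, β, hβ, hx⟩ := exists_integral_div x
  have hinj : Function.Injective (algebraMap (𝓞 F) (𝓞 M)) :=
    FaithfulSMul.algebraMap_injective _ _
  have hβ' : algebraMap (𝓞 F) (𝓞 M) β ≠ 0 := fun h ↦ hβ (hinj (by rw [h, map_zero]))
  have hx' : algebraMap F M x =
      (algebraMap (𝓞 F) (𝓞 M) α : M) / (algebraMap (𝓞 F) (𝓞 M) β : M) := by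
    rw [hx, map_div₀]; rfl
  have h1 := denomIdeal_mul_span F hβ hx
  have h2 := denomIdeal_mul_span M hβ' hx'
  have h3 : denomIdeal M (algebraMap F M x) =
      (denomIdeal F x).map (algebraMap (𝓞 F) (𝓞 M)) := by
    have h4 := congrArg (Ideal.map (algebraMap (𝓞 F) (𝓞 M))) h1
    rw [Ideal.map_mul, Ideal.map_span, Ideal.map_span, Set.image_pair, Set.image_singleton,
      ← h2] at h4
    refine (mul_right_cancel₀ ?_ h4).symm
    intro h
    rw [h, mul_zero] at h2
    exact hβ' (by simpa using h2.symm)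
  rw [h3, Ideal.absNorm_algebraMap, IsFractionRing.finrank_eq (𝓞 F) F (𝓞 M) M]

/-- The absolute Weil height does not depend on the ambient number field. -/
lemma nfHeight_algebraMap (F M : Type*) [Field F] [NumberField F] [Field M]
    [NumberField M] [Algebra F M] (x : F) :
    nfHeight M (algebraMap F M x) = nfHeight F x := by
  have hF : (Module.finrank ℚ F : ℝ) ≠ 0 := by exact_mod_cast Module.finrank_pos.ne'
  have hM : (Module.finrank F M : ℝ) ≠ 0 := by
    have : FiniteDimensional F M := Module.Finite.right ℚ F M
    exact_mod_cast Module.finrank_pos.ne'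
  have hs := sum_embeddings_algebraMap F M fun φ ↦ Real.log (max 1 ‖φ x‖)
  simp only [RingHom.comp_apply] at hs
  rw [nfHeight, nfHeight, absNorm_denomIdeal_algebraMap,
    sum_infinitePlace_eq_sum_embeddings M _ (fun r ↦ Real.log (max 1 r)),
    sum_infinitePlace_eq_sum_embeddings F _ (fun r ↦ Real.log (max 1 r)), hs, Nat.cast_pow,
    Real.log_pow, ← Module.finrank_mul_finrank ℚ F M]
  push_cast
  field_simp

lemma nfHeight_map {F M : Type*} [Field F] [NumberField F] [Field M]
    [NumberField M] (f : F →+* M) (x : F) : nfHeight M (f x) = nfHeight F x := by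
  algebraize [f]
  exact nfHeight_algebraMap F M x

/-- If `t` generates `F` and `t ^ N = 2`, the derivative of `X ^ N - 2` at `t` lies in the
different ideal of `F`. -/
lemma mul_pow_mem_differentIdeal {F : Type*} [Field F] [NumberField F] {N : ℕ} (t : 𝓞 F)
    (ht : t ^ N = 2) (hgen : Algebra.adjoin ℚ {(t : F)} = ⊤) :
    (N : 𝓞 F) * t ^ (N - 1) ∈ differentIdeal ℤ (𝓞 F) := by
  have h1 := aeval_derivative_mem_differentIdeal ℤ ℚ F t hgen
  obtain ⟨g, hg⟩ := minpoly.isIntegrallyClosed_dvd (RingOfIntegers.isIntegral t)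
    (p := (X ^ N - C 2 : ℤ[X]))
    (by rw [map_sub, map_pow, aeval_X, aeval_C, ht, map_ofNat, sub_self])
  have h2 := congrArg (fun q ↦ aeval t (derivative q)) hg
  simp only [derivative_sub, derivative_X_pow, derivative_C, sub_zero, derivative_mul, map_add,
    map_mul, map_pow, aeval_X, aeval_C, minpoly.aeval, zero_mul, add_zero] at h2
  have h3 : (N : 𝓞 F) * t ^ (N - 1) =
      aeval t (derivative (minpoly ℤ t)) * aeval t g := by
    rw [← h2]; simp
  rw [h3]
  exact Ideal.mul_mem_right _ _ h1

lemma five_notMem_sq {F : Type*} [Field F] [NumberField F] {N : ℕ} (t : 𝓞 F)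
    (ht : t ^ N = 2) (hgen : Algebra.adjoin ℚ {(t : F)} = ⊤) (hN : N.Coprime 5) (hN0 : N ≠ 0)
    (P : HeightOneSpectrum (𝓞 F)) (hP : (5 : 𝓞 F) ∈ P.asIdeal) : (5 : 𝓞 F) ∉ P.asIdeal ^ 2 := by
  intro h5
  have hmax : (Ideal.span {(5 : ℤ)}).IsMaximal :=
    PrincipalIdealRing.isMaximal_of_irreducible
      (Int.prime_iff_natAbs_prime.mpr (by norm_num)).irreducible
  have hd : P.asIdeal ^ 2 ∣ (Ideal.span {(5 : ℤ)}).map (algebraMap ℤ (𝓞 F)) := by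
    rw [Ideal.map_span, Set.image_singleton, Ideal.dvd_span_singleton]
    simpa using h5
  have h1 := pow_sub_one_dvd_differentIdeal ℤ P.asIdeal 2 (by simp) hd
  rw [Nat.add_one_sub_one, pow_one, Ideal.dvd_iff_le] at h1
  have h2 := Ideal.mul_mem_right t _ (h1 (mul_pow_mem_differentIdeal t ht hgen))
  rw [mul_assoc, ← pow_succ, Nat.sub_add_cancel (Nat.one_le_iff_ne_zero.mpr hN0), ht] at h2
  have hcop : IsCoprime ((N : ℤ) * 2) 5 := by
    rw [Int.isCoprime_iff_gcd_eq_one]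
    have : Nat.Coprime (N * 2) 5 := hN.mul_left (by norm_num)
    exact_mod_cast this
  obtain ⟨u, v, huv⟩ := hcop
  apply P.isPrime.ne_top
  rw [Ideal.eq_top_iff_one]
  have h3 := congrArg (fun z : ℤ ↦ (z : 𝓞 F)) huv
  push_cast at h3
  rw [← h3]
  exact Ideal.add_mem _ (Ideal.mul_mem_left _ _ h2) (Ideal.mul_mem_left _ _ hP)

/-- Every element of `F = ℚ(2 ^ (1 / N))` has an absolute value in the group generated by that of
`5`, at any place above `5` of any extension of `F`. -/
lemma exists_zpow_eq_finitePlace {F M : Type*} [Field F] [NumberField F] [Field M] [NumberField M]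
    [Algebra F M] {N : ℕ} (t : 𝓞 F)
    (ht : t ^ N = 2) (hgen : Algebra.adjoin ℚ {(t : F)} = ⊤) (hN : N.Coprime 5) (hN0 : N ≠ 0)
    (w : FinitePlace M) (hw : w 5 < 1) {a : F} (ha : a ≠ 0) :
    ∃ k : ℤ, w (algebraMap F M a) = w 5 ^ k := by
  set Q := w.maximalIdeal with hQ
  set P : HeightOneSpectrum (𝓞 F) := Q.under (𝓞 F) with hPdef
  have hval : ∀ x : M, w x =
      WithZeroMulInt.toNNReal (HeightOneSpectrum.absNorm_ne_zero Q) (Q.valuation M x) := by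
    intro x
    rw [← FinitePlace.norm_embedding_eq, FinitePlace.norm_embedding']
  have h5Q : (5 : 𝓞 M) ∈ Q.asIdeal := by
    rw [← FinitePlace.norm_lt_one_iff_mem M, FinitePlace.norm_embedding_eq]
    rwa [map_ofNat (algebraMap (𝓞 M) M) 5]
  have h5P : (5 : 𝓞 F) ∈ P.asIdeal := by
    change algebraMap (𝓞 F) (𝓞 M) 5 ∈ Q.asIdeal
    rwa [map_ofNat (algebraMap (𝓞 F) (𝓞 M)) 5]
  have hover : Q.asIdeal.LiesOver P.asIdeal := ⟨rfl⟩
  have h5 : P.valuation F 5 = WithZero.exp (-1 : ℤ) := by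
    have h1 : P.intValuation 5 ≤ WithZero.exp (-((1 : ℕ) : ℤ)) := by
      rw [HeightOneSpectrum.intValuation_le_pow_iff_mem, pow_one]; exact h5P
    have h2 : ¬ P.intValuation 5 ≤ WithZero.exp (-((2 : ℕ) : ℤ)) := by
      rw [HeightOneSpectrum.intValuation_le_pow_iff_mem]
      exact five_notMem_sq t ht hgen hN hN0 P h5P
    have h3 : P.valuation F 5 = P.intValuation 5 := by
      rw [← HeightOneSpectrum.valuation_of_algebraMap (K := F)]
      exact congrArg _ (map_ofNat (algebraMap (𝓞 F) F) 5).symm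
    rw [h3]
    have h0 : P.intValuation 5 ≠ 0 := HeightOneSpectrum.intValuation_ne_zero _ _ (by norm_num)
    obtain ⟨m, hm⟩ : ∃ m : ℤ, P.intValuation 5 = WithZero.exp m :=
      ⟨_, (WithZero.exp_log h0).symm⟩
    rw [hm, WithZero.exp_le_exp] at h1 h2
    rw [hm]
    congr 1
    push_cast at h1 h2
    omega
  have ha0 : P.valuation F a ≠ 0 := (Valuation.ne_zero_iff _).mpr ha
  refine ⟨-WithZero.log (P.valuation F a), ?_⟩
  have hk : P.valuation F a = P.valuation F 5 ^ (-WithZero.log (P.valuation F a)) := by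
    rw [h5, ← WithZero.exp_zsmul]
    simp [WithZero.exp_log ha0]
  set k := -WithZero.log (P.valuation F a)
  have e1 := HeightOneSpectrum.valuation_liesOver M P Q a
  have e2 := HeightOneSpectrum.valuation_liesOver M P Q (5 : F)
  rw [map_ofNat (algebraMap F M) 5] at e2
  rw [hval, hval, ← e1, ← e2, hk]
  simp only [map_pow, map_zpow₀, NNReal.coe_pow, NNReal.coe_zpow]
  rw [← zpow_natCast, ← zpow_natCast, ← zpow_mul, ← zpow_mul, mul_comm]

lemma finitePlace_natCast_le_one {M : Type*} [Field M] [NumberField M] (w : FinitePlace M) (n : ℕ) :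
    w (n : M) ≤ 1 := by
  induction n with
  | zero => simp
  | succ n ih =>
    rw [Nat.cast_succ]
    exact (w.add_le _ _).trans (max_le ih (map_one w).le)

/-- If `a` and `b` have absolute values in the group generated by `|5| < 1`, then `a ^ 2` and
`5 * b ^ 2` have distinct absolute values, so there is no cancellation in `a ^ 2 - 5 * b ^ 2`. -/
lemma zpow_le_finitePlace_sq_sub {M : Type*} [Field M] [NumberField M] (w : FinitePlace M)
    (hw : w 5 < 1) {a b : M} (ha : a ≠ 0 → ∃ k : ℤ, w a = w 5 ^ k) {k : ℤ} (hb : w b = w 5 ^ k) :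
    w 5 ^ (2 * k + 1) ≤ w (a ^ 2 - 5 * b ^ 2) := by
  have hg : 0 < w 5 := FinitePlace.pos_iff.mpr (by norm_num)
  have h5b : w (5 * b ^ 2) = w 5 ^ (2 * k + 1) := by
    rw [map_mul, map_pow, hb, zpow_add₀ hg.ne', zpow_one, mul_comm 2 k, zpow_mul, mul_comm]
    rfl
  rw [← h5b]
  by_contra! hlt
  have h1 : w (5 * b ^ 2) ≤ w (a ^ 2) := by
    have h := w.add_le (a ^ 2) (-(a ^ 2 - 5 * b ^ 2))
    rw [map_neg_eq_map, show a ^ 2 + -(a ^ 2 - 5 * b ^ 2) = 5 * b ^ 2 by ring] at h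
    exact (le_max_iff.mp h).resolve_right hlt.not_ge
  have h2 : w (a ^ 2) ≤ w (5 * b ^ 2) := by
    have h := w.add_le (a ^ 2 - 5 * b ^ 2) (5 * b ^ 2)
    rwa [sub_add_cancel, max_eq_right hlt.le] at h
  have h3 := h2.antisymm h1
  have ha0 : a ≠ 0 := by
    rintro rfl
    have : 0 < w (5 * b ^ 2) := h5b ▸ zpow_pos hg _
    rw [zero_pow two_ne_zero, map_zero] at h3
    exact this.ne h3
  obtain ⟨j, hj⟩ := ha ha0
  rw [h5b, map_pow, hj, ← zpow_natCast, ← zpow_mul] at h3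
  have := zpow_right_injective₀ hg hw.ne h3
  push_cast at this
  omega

lemma finitePlace_sub_sq_le {M : Type*} [Field M] [NumberField M] (w : FinitePlace M)
    {a b s : M} (hs : s ^ 2 = 5) (ha : w 5 < 1 → a ≠ 0 → ∃ k : ℤ, w a = w 5 ^ k)
    (hb : w 5 < 1 → ∃ k : ℤ, w b = w 5 ^ k) :
    w (2 * b * s) ^ 2 ≤ w 5 * (max (w (a + b * s)) 1 ^ 2 * max (w (a - b * s)) 1 ^ 2) := by
  have hg : 0 < w 5 := FinitePlace.pos_iff.mpr (by norm_num)
  have h2 : w 2 ≤ 1 := by exact_mod_cast finitePlace_natCast_le_one w 2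
  set A := max (w (a + b * s)) 1
  set B := max (w (a - b * s)) 1
  have hA : 1 ≤ A := le_max_right _ _
  have hB : 1 ≤ B := le_max_right _ _
  have hA' : w (a + b * s) ≤ A := le_max_left _ _
  have hB' : w (a - b * s) ≤ B := le_max_left _ _
  have h5 : w 5 ≤ 1 := by exact_mod_cast finitePlace_natCast_le_one w 5
  rw [← mul_pow]
  have hAB : 1 ≤ A * B := one_le_mul_of_one_le_of_one_le hA hB
  rcases h5.eq_or_lt with h5 | h5
  · rw [h5, one_mul]
    refine pow_le_pow_left₀ (apply_nonneg w _) ?_ 2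
    have h := w.add_le (a + b * s) (-(a - b * s))
    rw [map_neg_eq_map, show a + b * s + -(a - b * s) = 2 * b * s by ring] at h
    refine h.trans (max_le (hA'.trans ?_) (hB'.trans ?_)) <;> nlinarith
  · obtain ⟨k, hk⟩ := hb h5
    have h4 : w (2 * b * s) ^ 2 ≤ w 5 ^ (2 * k + 1) := by
      have : w (2 * b * s) ^ 2 = w 2 ^ 2 * w 5 ^ (2 * k + 1) := by
        rw [← map_pow, mul_pow, hs, mul_pow, map_mul, map_mul, map_pow, map_pow, hk,
          zpow_add₀ hg.ne', zpow_one, mul_comm 2 k, zpow_mul, mul_assoc]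
        rfl
      rw [this]
      exact mul_le_of_le_one_left (zpow_pos hg _).le (pow_le_one₀ (apply_nonneg w _) h2)
    refine h4.trans ?_
    rcases le_or_gt 0 k with h0 | h0
    · calc w 5 ^ (2 * k + 1) ≤ w 5 ^ (1 : ℤ) := zpow_le_zpow_right_of_le_one₀ hg h5.le (by omega)
        _ = w 5 * 1 := by simp
        _ ≤ w 5 * (A * B) ^ 2 := by gcongr; exact one_le_pow₀ hAB
    · have h6 : w 5 ^ (2 * k + 1) ≤ A * B := by
        refine (zpow_le_finitePlace_sq_sub w h5 (ha h5) hk).trans ?_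
        rw [show a ^ 2 - 5 * b ^ 2 = (a + b * s) * (a - b * s) by rw [← hs]; ring, map_mul]
        exact mul_le_mul hA' hB' (apply_nonneg w _) (zero_le_one.trans hA)
      calc w 5 ^ (2 * k + 1) ≤ w 5 ^ (1 + ((2 * k + 1) + (2 * k + 1))) :=
            zpow_le_zpow_right_of_le_one₀ hg h5.le (by omega)
        _ = w 5 * (w 5 ^ (2 * k + 1)) ^ 2 := by
            rw [zpow_add₀ hg.ne', zpow_add₀ hg.ne', zpow_one, pow_two]
        _ ≤ w 5 * (A * B) ^ 2 := by
            gcongr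

lemma infinitePlace_sub_sq_le {M : Type*} [Field M] (w : InfinitePlace M) (x y : M) :
    w (x - y) ^ 2 ≤ 4 * (max (w x) 1 ^ 2 * max (w y) 1 ^ 2) := by
  have h1 : w (x - y) ≤ w x + w y := by
    have h := w.1.add_le x (-y)
    rwa [w.1.map_neg, ← sub_eq_add_neg] at h
  have hx : w x ≤ max (w x) 1 := le_max_left _ _
  have hy : w y ≤ max (w y) 1 := le_max_left _ _
  have hx' : 1 ≤ max (w x) 1 := le_max_right _ _
  have hy' : 1 ≤ max (w y) 1 := le_max_right _ _
  calc w (x - y) ^ 2 ≤ (2 * (max (w x) 1 * max (w y) 1)) ^ 2 :=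
        pow_le_pow_left₀ (apply_nonneg w _) (by nlinarith) 2
    _ = _ := by ring

lemma finprod_finitePlace_five (M : Type*) [Field M] [NumberField M] :
    ∏ᶠ w : FinitePlace M, w 5 = ((5 : ℝ) ^ Module.finrank ℚ M)⁻¹ := by
  rw [FinitePlace.prod_eq_inv_abs_norm (by norm_num)]
  have : Algebra.norm ℚ (5 : M) = 5 ^ Module.finrank ℚ M := by
    rw [← map_ofNat (algebraMap ℚ M) 5, Algebra.norm_algebraMap]
  rw [this]
  push_cast
  rw [abs_of_pos (by positivity)]

/-- The lower bound for the height of elements of `M = F(√5)` outside `F`, when `F` is unramified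
above `5`. -/
lemma log_le_nfHeight {M : Type*} [Field M] [NumberField M] {a b s : M} (hs : s ^ 2 = 5)
    (hb0 : b ≠ 0)
    (ha : ∀ w : FinitePlace M, w 5 < 1 → a ≠ 0 → ∃ k : ℤ, w a = w 5 ^ k)
    (hb : ∀ w : FinitePlace M, w 5 < 1 → ∃ k : ℤ, w b = w 5 ^ k) :
    Real.log (5 / 4) ≤ 2 * nfHeight M (a + b * s) + 2 * nfHeight M (a - b * s) := by
  set x := a + b * s
  set y := a - b * s
  set d := Module.finrank ℚ M with hdef
  have hd : 0 < (d : ℝ) := by exact_mod_cast Module.finrank_pos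
  have hs0 : s ≠ 0 := by rintro rfl; norm_num at hs
  have hxy : x - y = 2 * b * s := by ring
  have hz : x - y ≠ 0 := by rw [hxy]; exact mul_ne_zero (mul_ne_zero two_ne_zero hb0) hs0
  have hprod := congrArg (· ^ 2) (prod_abs_eq_one hz)
  simp only [mul_pow, one_pow] at hprod
  have hinf : (∏ w : InfinitePlace M, w (x - y) ^ w.mult) ^ 2 ≤
      4 ^ d * ((∏ w : InfinitePlace M, max (w x) 1 ^ w.mult) ^ 2 *
        (∏ w : InfinitePlace M, max (w y) 1 ^ w.mult) ^ 2) := by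
    rw [hdef, ← InfinitePlace.sum_mult_eq (K := M), ← Finset.prod_pow_eq_pow_sum, ← Finset.prod_pow,
      ← Finset.prod_pow, ← Finset.prod_pow, ← Finset.prod_mul_distrib, ← Finset.prod_mul_distrib]
    refine Finset.prod_le_prod (fun w _ ↦ by positivity) fun w _ ↦ ?_
    rw [pow_right_comm, pow_right_comm _ _ 2, pow_right_comm _ _ 2, ← mul_pow, ← mul_pow]
    exact pow_le_pow_left₀ (by positivity) (infinitePlace_sub_sq_le w x y) _
  have hfin : (∏ᶠ w : FinitePlace M, w (x - y)) ^ 2 ≤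
      (5 ^ d)⁻¹ * ((∏ᶠ w : FinitePlace M, max (w x) 1) ^ 2 *
        (∏ᶠ w : FinitePlace M, max (w y) 1) ^ 2) := by
    have hsub := FinitePlace.hasFiniteMulSupport hz
    have hx := hasFiniteMulSupport_max_one x
    have hy := hasFiniteMulSupport_max_one y
    have hfive := FinitePlace.hasFiniteMulSupport (show (5 : M) ≠ 0 by norm_num)
    have hx2 : (fun v : FinitePlace M ↦ max (v x) 1 ^ 2).HasFiniteMulSupport := hx.pow 2
    have hy2 : (fun v : FinitePlace M ↦ max (v y) 1 ^ 2).HasFiniteMulSupport := hy.pow 2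
    have hxy2 : (fun v : FinitePlace M ↦ max (v x) 1 ^ 2 * max (v y) 1 ^ 2).HasFiniteMulSupport :=
      hx2.mul hy2
    rw [← finprod_finitePlace_five, finprod_pow hsub, finprod_pow hx, finprod_pow hy,
      ← finprod_mul_distrib hx2 hy2, ← finprod_mul_distrib hfive hxy2]
    refine finprod_le_finprod (hsub.pow 2) (fun w ↦ sq_nonneg _) (hfive.mul hxy2) fun w ↦ ?_
    rw [hxy]
    exact finitePlace_sub_sq_le w hs (ha w) (hb w)
  have hH : 1 ≤ (4 / 5 : ℝ) ^ d * (Height.mulHeight₁ x ^ 2 * Height.mulHeight₁ y ^ 2) := by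
    rw [← hprod, mulHeight₁_eq, mulHeight₁_eq, div_pow]
    refine (mul_le_mul hinf hfin (by positivity) (by positivity)).trans_eq ?_
    ring
  have hlog := Real.log_le_log one_pos hH
  have px := Height.mulHeight₁_pos x
  have py := Height.mulHeight₁_pos y
  rw [Real.log_one, Real.log_mul (by positivity) (by positivity),
    Real.log_mul (by positivity) (by positivity), Real.log_pow, Real.log_pow, Real.log_pow,
    ← Height.logHeight₁_eq_log_mulHeight₁, ← Height.logHeight₁_eq_log_mulHeight₁,
    show (4 / 5 : ℝ) = (5 / 4)⁻¹ by norm_num, Real.log_inv] at hlog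
  rw [nfHeight_eq_logHeight₁, nfHeight_eq_logHeight₁, ← hdef]
  push_cast at hlog
  field_simp
  linarith

/-- The height of an algebraic number can be computed in any number field containing it. -/
lemma algHeight_apply {M : Type*} [Field M] [NumberField M] (i : M →+* ℂ) (y : M) :
    algHeight (i y) = nfHeight M y := by
  have hy : IsIntegral ℚ y := IsIntegral.of_finite ℚ y
  have hx : IsIntegral ℚ (i y) := hy.map i.toRatAlgHom
  have : FiniteDimensional ℚ ℚ⟮i y⟯ := adjoin.finiteDimensional hx
  have : NumberField ℚ⟮i y⟯ := ⟨⟩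
  rw [algHeight, dif_pos hx]
  have hroot : aeval y (minpoly ℚ (i y)) = 0 := by
    have h := minpoly.algHom_eq i.toRatAlgHom i.injective y
    rw [RingHom.toRatAlgHom_apply] at h
    rw [h]
    exact minpoly.aeval ℚ y
  let f := (algHomAdjoinIntegralEquiv ℚ hx (K := M)).symm
    ⟨y, mem_aroots.mpr ⟨minpoly.ne_zero hx, hroot⟩⟩
  have hf : f (AdjoinSimple.gen ℚ (i y)) = y := algHomAdjoinIntegralEquiv_symm_apply_gen ..
  rw [← nfHeight_map f.toRingHom]
  exact congrArg _ hf

lemma nfHeight_pow (M : Type*) [Field M] [NumberField M] (x : M) (n : ℕ) :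
    nfHeight M (x ^ n) = n * nfHeight M x := by
  rw [nfHeight_eq_logHeight₁, nfHeight_eq_logHeight₁, Height.logHeight₁_pow]
  ring

lemma nfHeight_two (M : Type*) [Field M] [NumberField M] : nfHeight M 2 = Real.log 2 := by
  rw [← map_ofNat (algebraMap ℚ M) 2, nfHeight_algebraMap, nfHeight_eq_logHeight₁]
  simpa using Rat.logHeight₁_natCast 2

lemma algHeight_of_pow_eq_two {x : ℂ} {N : ℕ} (hN : N ≠ 0) (hx : x ^ N = 2) :
    algHeight x = Real.log 2 / N := by
  have hintegral : IsIntegral ℚ x := IsIntegral.of_pow (Nat.pos_of_ne_zero hN) (by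
    rw [hx, ← map_ofNat (algebraMap ℚ ℂ) 2]
    exact isIntegral_algebraMap)
  have : FiniteDimensional ℚ ℚ⟮x⟯ := adjoin.finiteDimensional hintegral
  have : NumberField ℚ⟮x⟯ := ⟨⟩
  have h1 := algHeight_apply (algebraMap ℚ⟮x⟯ ℂ) (AdjoinSimple.gen ℚ x)
  rw [AdjoinSimple.algebraMap_gen] at h1
  have h2 : AdjoinSimple.gen ℚ x ^ N = 2 := by
    apply (algebraMap ℚ⟮x⟯ ℂ).injective
    rw [map_pow, AdjoinSimple.algebraMap_gen, hx, map_ofNat]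
  have h3 := nfHeight_pow _ (AdjoinSimple.gen ℚ x) N
  rw [h2, nfHeight_two] at h3
  rw [h1, h3]
  field_simp

lemma rat_pow_ne_prime {p n : ℕ} (hp : p.Prime) (hn : n ≠ 1) (b : ℚ) : b ^ n ≠ p := by
  intro h
  have : Fact p.Prime := ⟨hp⟩
  have hb : b ≠ 0 := by
    rintro rfl
    rcases eq_or_ne n 0 with rfl | hn0
    · rw [pow_zero] at h
      exact hp.one_lt.ne (by exact_mod_cast h)
    · rw [zero_pow hn0] at h
      exact hp.ne_zero (by exact_mod_cast h.symm)
  have h1 := congrArg (padicValRat p) h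
  rw [padicValRat.pow, padicValRat.self hp.one_lt] at h1
  exact hn (by exact_mod_cast Int.eq_one_or_neg_one_of_mul_eq_one h1 |>.resolve_right (by omega))

lemma finrank_adjoin_of_pow {N : ℕ} (hN : N ≠ 0) {c : ℚ} {x : ℂ} (hx : x ^ N = c)
    (hirr : Irreducible (X ^ N - C c : ℚ[X])) : Module.finrank ℚ ℚ⟮x⟯ = N := by
  have hmin : X ^ N - C c = minpoly ℚ x :=
    minpoly.eq_of_irreducible_of_monic hirr (by simp [hx]) (monic_X_pow_sub_C c hN)
  have hintegral : IsIntegral ℚ x := ⟨_, monic_X_pow_sub_C c hN, by simp [hx]⟩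
  rw [adjoin.finrank hintegral, ← hmin, natDegree_X_pow_sub_C]

/-- The nontrivial `E`-conjugation of `E(√5)` when `√5 ∉ E`. -/
lemma exists_conj {E : Type*} [Field E] [Algebra E ℂ] {s : ℂ} (hs : s ^ 2 = 5)
    (hsE : ∀ r : E, algebraMap E ℂ r ≠ s) :
    ∃ σ : E⟮s⟯ →ₐ[E] E⟮s⟯, σ (AdjoinSimple.gen E s) = -AdjoinSimple.gen E s := by
  have haev : aeval s (X ^ 2 - C 5 : E[X]) = 0 := by
    rw [map_sub, map_pow, aeval_X, aeval_C, hs, map_ofNat, sub_self]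
  have hintegral : IsIntegral E s := ⟨_, monic_X_pow_sub_C 5 two_ne_zero, haev⟩
  have hirr : Irreducible (X ^ 2 - C 5 : E[X]) := by
    refine X_pow_sub_C_irreducible_of_prime Nat.prime_two fun b hb ↦ ?_
    have : (algebraMap E ℂ b) ^ 2 = s ^ 2 := by rw [← map_pow, hb, hs, map_ofNat]
    rcases sq_eq_sq_iff_eq_or_eq_neg.mp this with h | h
    · exact hsE b h
    · exact hsE (-b) (by rw [map_neg, h, neg_neg])
  have hmin : X ^ 2 - C 5 = minpoly E s :=
    minpoly.eq_of_irreducible_of_monic hirr haev (monic_X_pow_sub_C 5 two_ne_zero)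
  have hroot : aeval (-AdjoinSimple.gen E s) (minpoly E (adjoin.powerBasis hintegral).gen) = 0 := by
    rw [adjoin.powerBasis_gen, minpoly_gen, ← hmin]
    apply (algebraMap E⟮s⟯ ℂ).injective
    rw [map_sub, map_pow, aeval_X, aeval_C, neg_sq, map_sub, map_pow, AdjoinSimple.algebraMap_gen,
      hs, map_ofNat, map_ofNat, sub_self, map_zero]
  refine ⟨(adjoin.powerBasis hintegral).lift _ hroot, ?_⟩
  have := (adjoin.powerBasis hintegral).lift_gen _ hroot
  rwa [adjoin.powerBasis_gen] at this

/-- Elements of a quadratic extension `K(s)` have the form `a + b * s`. -/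
lemma exists_add_mul_of_mem_adjoin {K : Type*} [Field K] [Algebra K ℂ] {s : ℂ} (hs : s ^ 2 = 5)
    {x : ℂ} (hx : x ∈ K⟮s⟯) : ∃ a b : K, x = algebraMap K ℂ a + algebraMap K ℂ b * s := by
  have haev : aeval s (X ^ 2 - C 5 : K[X]) = 0 := by
    rw [map_sub, map_pow, aeval_X, aeval_C, hs, map_ofNat, sub_self]
  have hmon : (X ^ 2 - C 5 : K[X]).Monic := monic_X_pow_sub_C 5 two_ne_zero
  have hintegral : IsIntegral K s := ⟨_, hmon, haev⟩
  rw [← mem_toSubalgebra, adjoin_simple_toSubalgebra_of_isAlgebraic hintegral.isAlgebraic,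
    Algebra.adjoin_singleton_eq_range_aeval] at hx
  obtain ⟨p, rfl⟩ := hx
  have hdeg : (p %ₘ (X ^ 2 - C 5)).natDegree ≤ 1 := by
    have := natDegree_modByMonic_lt p hmon (fun h ↦ by
      have := congrArg natDegree h
      rw [natDegree_X_pow_sub_C, natDegree_one] at this
      omega)
    rw [natDegree_X_pow_sub_C] at this
    omega
  obtain ⟨b, a, hab⟩ := exists_eq_X_add_C_of_natDegree_le_one hdeg
  refine ⟨a, b, ?_⟩
  have := congrArg (aeval s) (modByMonic_add_div p (X ^ 2 - C 5 : K[X]))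
  rw [map_add, map_mul, haev, zero_mul, add_zero, hab] at this
  change aeval s p = _
  rw [← this, map_add, map_mul, aeval_C, aeval_C, aeval_X, add_comm]

/-- The positive real `3 ^ n`-th root of `2`. -/
def twoRoot (n : ℕ) : ℂ := 2 ^ (((3 ^ n : ℕ) : ℂ)⁻¹)

lemma twoRoot_pow (n : ℕ) : twoRoot n ^ 3 ^ n = 2 := by
  rw [twoRoot, Complex.cpow_nat_inv_pow _ (by positivity)]

lemma twoRoot_succ_pow (n : ℕ) : twoRoot (n + 1) ^ 3 = twoRoot n := by
  rw [twoRoot, twoRoot, ← Complex.cpow_mul_nat]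
  congr 1
  push_cast
  field_simp
  ring

lemma isIntegral_twoRoot (n : ℕ) : IsIntegral ℤ (twoRoot n) :=
  IsIntegral.of_pow (n := 3 ^ n) (by positivity) (by
    rw [twoRoot_pow, ← map_ofNat (algebraMap ℤ ℂ) 2]
    exact isIntegral_algebraMap)

lemma finrank_adjoin_twoRoot (n : ℕ) : Module.finrank ℚ ℚ⟮twoRoot n⟯ = 3 ^ n := by
  refine finrank_adjoin_of_pow (c := 2) (by positivity) (by simp [twoRoot_pow]) ?_
  exact X_pow_sub_C_irreducible_of_prime_pow Nat.prime_three (by norm_num) n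
    fun b ↦ by exact_mod_cast rat_pow_ne_prime Nat.prime_two (by norm_num) b

lemma numberField_adjoin_twoRoot (n : ℕ) : NumberField ℚ⟮twoRoot n⟯ :=
  have : FiniteDimensional ℚ ℚ⟮twoRoot n⟯ :=
    adjoin.finiteDimensional (isIntegral_twoRoot n).tower_top
  ⟨⟩

lemma monotone_adjoin_twoRoot : Monotone fun n ↦ ℚ⟮twoRoot n⟯ :=
  monotone_nat_of_le_succ fun n ↦ adjoin_simple_le_iff.mpr <|
    twoRoot_succ_pow n ▸
      ℚ⟮twoRoot (n + 1)⟯.pow_mem (mem_adjoin_simple_self ℚ (twoRoot (n + 1))) 3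

/-- The field generated by all `3 ^ n`-th roots of `2` in the tower. -/
def twoTower : IntermediateField ℚ ℂ := ⨆ n, ℚ⟮twoRoot n⟯

lemma adjoin_twoRoot_le_twoTower (n : ℕ) : ℚ⟮twoRoot n⟯ ≤ twoTower :=
  le_iSup (fun n ↦ ℚ⟮twoRoot n⟯) n

lemma mem_twoTower {x : ℂ} : x ∈ twoTower ↔ ∃ n, x ∈ ℚ⟮twoRoot n⟯ := by
  rw [twoTower, ← SetLike.mem_coe, coe_iSup_of_directed monotone_adjoin_twoRoot.directed_le]
  simp

lemma mem_Qbar {x : ℂ} (hx : IsIntegral ℚ x) : x ∈ Qbar :=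
  mem_algebraicClosure_iff.mpr hx.isAlgebraic

lemma twoTower_le_Qbar : twoTower ≤ Qbar :=
  iSup_le fun n ↦ adjoin_simple_le_iff.mpr (mem_Qbar (isIntegral_twoRoot n).tower_top)

lemma sqrt_five_notMem_adjoin {s : ℂ} (hs : s ^ 2 = 5) (n : ℕ) : s ∉ ℚ⟮twoRoot n⟯ := by
  intro h
  have h2 : Module.finrank ℚ ℚ⟮s⟯ = 2 :=
    finrank_adjoin_of_pow (c := 5) two_ne_zero (by simp [hs])
      (X_pow_sub_C_irreducible_of_prime Nat.prime_two
        fun b ↦ by exact_mod_cast rat_pow_ne_prime Nat.prime_five (by norm_num) b)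
  have hd := finrank_dvd_of_le_right (adjoin_simple_le_iff.mpr h)
  rw [h2, finrank_adjoin_twoRoot] at hd
  have := Nat.prime_two.dvd_of_dvd_pow hd
  omega

lemma sqrt_five_notMem_twoTower {s : ℂ} (hs : s ^ 2 = 5) : s ∉ twoTower := fun h ↦
  have ⟨n, hn⟩ := mem_twoTower.mp h
  sqrt_five_notMem_adjoin hs n hn

lemma not_finiteDimensional_twoTower : ¬ FiniteDimensional ℚ twoTower := by
  intro h
  have h1 := finrank_le_of_le_right (adjoin_twoRoot_le_twoTower (Module.finrank ℚ twoTower))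
  rw [finrank_adjoin_twoRoot] at h1
  exact h1.not_gt (Nat.lt_pow_self (by norm_num))

lemma not_hasBogomolovProperty_twoTower : ¬ HasBogomolovProperty twoTower := by
  rintro ⟨ε, hε, h⟩
  have hlog : 0 < Real.log 2 := Real.log_pos one_lt_two
  obtain ⟨n, hn⟩ := pow_unbounded_of_one_lt (Real.log 2 / ε) (show (1 : ℝ) < 3 by norm_num)
  have hheight := algHeight_of_pow_eq_two (by positivity) (twoRoot_pow n)
  push_cast at hheight
  refine h (twoRoot n) (adjoin_twoRoot_le_twoTower n (mem_adjoin_simple_self ℚ _)) ?_ ?_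
  · intro h0
    have h1 := twoRoot_pow n
    rw [h0, zero_pow (by positivity)] at h1
    exact two_ne_zero h1.symm
  · rw [hheight]
    refine ⟨by positivity, ?_⟩
    rw [div_lt_iff₀ hε] at hn
    rwa [div_lt_iff₀ (by positivity), mul_comm]

/-- Elements of `ℚ(2 ^ (1 / 3 ^ n), √5)` outside `ℚ(2 ^ (1 / 3 ^ n))` have height bounded below,
uniformly in `n`. -/
lemma log_le_algHeight {s : ℂ} (hs : s ^ 2 = 5) {n : ℕ}
    {E : IntermediateField ℚ ℂ} (hE : E = ℚ⟮twoRoot n⟯) (a b : E) (hb : b ≠ 0) :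
    Real.log (5 / 4) / 4 ≤ algHeight (a + b * s) := by
  have : NumberField E := hE ▸ numberField_adjoin_twoRoot n
  have hintegral : IsIntegral E s := IsIntegral.of_pow two_pos (by
    rw [hs, ← map_ofNat (algebraMap E ℂ) 5]
    exact isIntegral_algebraMap)
  have : FiniteDimensional E E⟮s⟯ := adjoin.finiteDimensional hintegral
  have : FiniteDimensional ℚ E⟮s⟯ := Module.Finite.trans E _
  have : NumberField E⟮s⟯ := ⟨⟩
  set g := AdjoinSimple.gen E s
  have hg : g ^ 2 = 5 := by
    apply (algebraMap E⟮s⟯ ℂ).injective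
    rw [map_pow, AdjoinSimple.algebraMap_gen, hs, map_ofNat]
  let τ : E := ⟨twoRoot n, hE ▸ mem_adjoin_simple_self ℚ _⟩
  have hτ : τ ^ 3 ^ n = 2 := by
    apply (algebraMap E ℂ).injective
    rw [map_pow, map_ofNat]
    exact twoRoot_pow n
  have hτint : IsIntegral ℤ τ := by
    rw [← isIntegral_algebraMap_iff (algebraMap E ℂ).injective]
    exact isIntegral_twoRoot n
  let t : 𝓞 E := ⟨τ, hτint⟩
  have ht : t ^ 3 ^ n = 2 := RingOfIntegers.coe_injective (by
    rw [map_pow, map_ofNat]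
    exact hτ)
  have hgen : Algebra.adjoin ℚ {(t : E)} = ⊤ := by
    subst hE
    exact (adjoin.powerBasis (isIntegral_twoRoot n).tower_top).adjoin_gen_eq_top
  have hval (w : FinitePlace E⟮s⟯) (hw : w 5 < 1) {c : E} (hc : c ≠ 0) :=
    exists_zpow_eq_finitePlace t ht hgen (Nat.Coprime.pow_left n (by norm_num)) (by positivity)
      w hw hc
  have key := log_le_nfHeight (a := algebraMap E E⟮s⟯ a) (b := algebraMap E E⟮s⟯ b) hg
    (by simpa using hb) (fun w hw ha ↦ hval w hw (by simpa using ha)) (fun w hw ↦ hval w hw hb)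
  obtain ⟨σ, hσ⟩ := exists_conj (E := E) hs
    (fun r hr ↦ sqrt_five_notMem_adjoin hs n (hE ▸ hr ▸ r.2))
  have hconj := nfHeight_map σ.toRingHom (algebraMap E E⟮s⟯ a + algebraMap E E⟮s⟯ b * g)
  have hconj' : σ.toRingHom (algebraMap E E⟮s⟯ a + algebraMap E E⟮s⟯ b * g) =
      algebraMap E E⟮s⟯ a - algebraMap E E⟮s⟯ b * g := by
    change σ _ = _
    rw [map_add, map_mul, σ.commutes, σ.commutes, hσ, mul_neg, ← sub_eq_add_neg]
  rw [hconj'] at hconj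
  have hheight := algHeight_apply (algebraMap E⟮s⟯ ℂ)
    (algebraMap E E⟮s⟯ a + algebraMap E E⟮s⟯ b * g)
  rw [map_add, map_mul, AdjoinSimple.algebraMap_gen] at hheight
  change algHeight (a + b * s) = _ at hheight
  rw [hheight]
  linarith

lemma isBogomolovExtension_twoTower {s : ℂ} (hs : s ^ 2 = 5) :
    IsBogomolovExtension twoTower (twoTower⟮s⟯.restrictScalars ℚ) := by
  refine ⟨Real.log (5 / 4) / 4, div_pos (Real.log_pos (by norm_num)) (by norm_num), ?_⟩
  intro x hx _ _ hlt
  obtain ⟨a, b, rfl⟩ := exists_add_mul_of_mem_adjoin hs hx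
  obtain ⟨m, hm⟩ := mem_twoTower.mp a.2
  obtain ⟨k, hk⟩ := mem_twoTower.mp b.2
  have ham := monotone_adjoin_twoRoot (le_max_left m k) hm
  have hbk := monotone_adjoin_twoRoot (le_max_right m k) hk
  by_cases hb : (b : ℂ) = 0
  · have : algebraMap twoTower ℂ a + algebraMap twoTower ℂ b * s = a := by
      change (a : ℂ) + b * s = a
      rw [hb, zero_mul, add_zero]
    rw [this]
    exact a.2
  · exact absurd hlt (log_le_algHeight hs rfl ⟨a, ham⟩ ⟨b, hbk⟩
      fun h ↦ hb (congrArg Subtype.val h)).not_gt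

end RelBogomolov

/-- There exist `ℚ ⊆ K ⊆ L ⊆ ℚ̄` with `K/ℚ` infinite, `K` failing (B), and `L/K` a finite
extension of degree `> 1` which is Bogomolov. -/
theorem exists_finite_bogomolovExtension :
    ∃ (K L : IntermediateField ℚ ℂ) (hKL : K ≤ L), L ≤ Qbar ∧
      ¬ FiniteDimensional ℚ ↥K ∧ ¬ HasBogomolovProperty K ∧
      FiniteDimensional ↥K ↥(extendScalars hKL) ∧ 1 < relfinrank K L ∧
      IsBogomolovExtension K L := by
  obtain ⟨s, hs⟩ : ∃ s : ℂ, s ^ 2 = 5 := IsAlgClosed.exists_pow_nat_eq 5 two_pos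
  have hsint : IsIntegral ℚ s := IsIntegral.of_pow two_pos (by
    rw [hs, ← map_ofNat (algebraMap ℚ ℂ) 5]
    exact isIntegral_algebraMap)
  have hKL : twoTower ≤ twoTower⟮s⟯.restrictScalars ℚ := fun x hx ↦
    twoTower⟮s⟯.algebraMap_mem ⟨x, hx⟩
  have hfin : FiniteDimensional twoTower (extendScalars hKL) := by
    have h : extendScalars hKL = twoTower⟮s⟯ := rfl
    rw [h]
    exact adjoin.finiteDimensional hsint.tower_top
  refine ⟨twoTower, twoTower⟮s⟯.restrictScalars ℚ, hKL, ?_, not_finiteDimensional_twoTower,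
    not_hasBogomolovProperty_twoTower, hfin, ?_, isBogomolovExtension_twoTower hs⟩
  · intro x hx
    obtain ⟨a, b, rfl⟩ := exists_add_mul_of_mem_adjoin hs hx
    exact add_mem (twoTower_le_Qbar a.2) (mul_mem (twoTower_le_Qbar b.2) (mem_Qbar hsint))
  · have hpos : 0 < relfinrank twoTower (twoTower⟮s⟯.restrictScalars ℚ) := by
      rw [relfinrank_eq_finrank_of_le hKL]
      exact Module.finrank_pos
    refine lt_of_le_of_ne hpos fun h ↦ sqrt_five_notMem_twoTower hs ?_
    exact relfinrank_eq_one_iff.mp h.symm (mem_adjoin_simple_self twoTower s)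
end
end

section
/- Let b be a positive rational number that is not the square of a rational number and not the cube of a rational number. Let K = ⋃_{n≥1} ℚ(b^{1/2^n}) ⊆ \overline{ℚ}, where b^{1/2^n} denotes the positive real 2^n-th root of b. Then b^{1/3} (the real cube root of b) does not lie in K, and the extension K(b^{1/3})/K is not Bogomolov: the elements b^{1/3}·b^x ∈ K(b^{1/3}) \ K, for rational x with denominator a power of 2 tending to −1/3, have positive height h(b^{1/3}·b^x) = |x + 1/3|·h(b) tending to 0. -/
open NumberField IntermediateField
open scoped Classical

noncomputable section

open RelBogomolov

namespace RelBogomolov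

theorem exists_ringOfIntegers_eq {F : Type*} [Field F] {x : F} (h : IsIntegral ℤ x) :
    ∃ t : 𝓞 F, algebraMap (𝓞 F) F t = x :=
  ⟨⟨x, h⟩, rfl⟩

/-- The denominator ideal of `x ^ N` is the `N`-th power of that of `x`. -/
theorem denomIdeal_pow (F : Type*) [Field F] [NumberField F] (x : F) (N : ℕ) :
    denomIdeal F (x ^ N) = denomIdeal F x ^ N := by
  obtain ⟨z, m, hm, rfl⟩ := IsFractionRing.div_surjective (A := 𝓞 F) x
  have hm0 : m ≠ 0 := nonZeroDivisors.ne_zero hm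
  have hmF : (algebraMap (𝓞 F) F m) ≠ 0 := by simpa using hm0
  have mem_iff (k : ℕ) (a : 𝓞 F) :
      a ∈ denomIdeal F ((algebraMap (𝓞 F) F z / algebraMap (𝓞 F) F m) ^ k) ↔
        m ^ k ∣ a * z ^ k := by
    change IsIntegral ℤ _ ↔ _
    constructor
    · intro h
      obtain ⟨t, ht⟩ := exists_ringOfIntegers_eq h
      refine ⟨t, RingOfIntegers.coe_injective ?_⟩
      rw [map_mul, map_mul, ht, map_pow, map_pow, div_pow]
      field_simp
    · rintro ⟨t, ht⟩
      have ht' := congrArg (algebraMap (𝓞 F) F) ht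
      simp only [map_mul, map_pow] at ht'
      have : (a : F) * (algebraMap (𝓞 F) F z / algebraMap (𝓞 F) F m) ^ k = t := by
        rw [div_pow]
        field_simp
        linear_combination ht'
      rw [this]
      exact RingOfIntegers.isIntegral_coe t
  set G : Ideal (𝓞 F) := Ideal.span {m} ⊔ Ideal.span {z} with hG
  have hG0 : G ≠ 0 := fun h ↦ hm0 <| by
    have : m ∈ G := Ideal.mem_sup_left (Ideal.mem_span_singleton_self m)
    simpa [h] using this
  obtain ⟨A, hA⟩ : G ∣ Ideal.span {m} := Ideal.dvd_iff_le.2 le_sup_left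
  obtain ⟨B, hB⟩ : G ∣ Ideal.span {z} := Ideal.dvd_iff_le.2 le_sup_right
  have hAB : IsCoprime A B := by
    rw [Ideal.isCoprime_iff_sup_eq, ← Ideal.one_eq_top]
    apply mul_left_cancel₀ hG0
    rw [Ideal.mul_sup, ← hA, ← hB, mul_one]
  have eq_pow (k : ℕ) :
      denomIdeal F ((algebraMap (𝓞 F) F z / algebraMap (𝓞 F) F m) ^ k) = A ^ k := by
    ext a
    rw [mem_iff, ← Ideal.span_singleton_le_span_singleton, ← Ideal.span_singleton_mul_span_singleton,
      ← Ideal.span_singleton_pow, ← Ideal.span_singleton_pow, hA, hB, ← Ideal.dvd_iff_le,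
      mul_pow, mul_pow, mul_left_comm, mul_dvd_mul_iff_left (pow_ne_zero k hG0),
      ← Ideal.dvd_span_singleton]
    exact ⟨hAB.pow.dvd_of_dvd_mul_right, fun h ↦ h.mul_right _⟩
  have h1 := eq_pow 1
  rw [pow_one, pow_one] at h1
  rw [eq_pow, h1]

theorem denomIdeal_ratCast (F : Type*) [Field F] [NumberField F] (r : ℚ) :
    denomIdeal F (r : F) = Ideal.span {(r.den : 𝓞 F)} := by
  have hd : (r.den : F) ≠ 0 := by exact_mod_cast r.den_nz
  have hr : (r : F) = r.num / r.den := Rat.cast_def r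
  ext a
  rw [Ideal.mem_span_singleton]
  change IsIntegral ℤ _ ↔ _
  constructor
  · intro h
    have hdvd : (r.den : 𝓞 F) ∣ a * (r.num : 𝓞 F) := by
      obtain ⟨t, ht⟩ := exists_ringOfIntegers_eq h
      refine ⟨t, RingOfIntegers.coe_injective ?_⟩
      rw [map_mul, map_mul, ht, map_natCast, map_intCast, hr]
      field_simp
    have hcop : IsCoprime (r.den : 𝓞 F) (r.num : 𝓞 F) := by
      have := (Rat.isCoprime_num_den r).symm.map (Int.castRingHom (𝓞 F))
      simpa using this
    exact hcop.dvd_of_dvd_mul_right hdvd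
  · rintro ⟨t, rfl⟩
    have : algebraMap (𝓞 F) F (r.den * t) * (r : F) = algebraMap (𝓞 F) F (t * r.num) := by
      rw [map_mul, map_mul, map_natCast, map_intCast, hr]
      field_simp
    rw [this]
    exact RingOfIntegers.isIntegral_coe _

/-- The height of an `N`-th root of a positive rational number in a number field. -/
theorem nfHeight_of_pow_eq_ratCast (F : Type*) [Field F] [NumberField F] {y : F} {N : ℕ}
    (hN : N ≠ 0) {r : ℚ} (hr : 0 < r) (h : y ^ N = (r : F)) :
    nfHeight F y = (N : ℝ)⁻¹ * (Real.log (max 1 (r : ℝ)) + Real.log r.den) := by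
  have hNR : (N : ℝ) ≠ 0 := by exact_mod_cast hN
  have hrank : (Module.finrank ℚ F : ℝ) ≠ 0 := by
    exact_mod_cast (Module.finrank_pos (R := ℚ) (M := F)).ne'
  have hplace (w : InfinitePlace F) :
      Real.log (max 1 (w y)) = (N : ℝ)⁻¹ * Real.log (max 1 (r : ℝ)) := by
    have hw : (w y) ^ N = (r : ℝ) := by
      rw [← map_pow, h, ← w.norm_embedding_eq, map_ratCast, Complex.norm_ratCast, abs_of_pos]
      exact_mod_cast hr
    have hmax : max 1 (r : ℝ) = (max 1 (w y)) ^ N := by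
      rw [← hw]
      rcases le_total 1 (w y) with h1 | h1
      · rw [max_eq_right h1, max_eq_right (one_le_pow₀ h1)]
      · rw [max_eq_left h1, max_eq_left (pow_le_one₀ (apply_nonneg w y) h1), one_pow]
    rw [hmax, Real.log_pow]
    field_simp
  have hnorm : Real.log (Ideal.absNorm (denomIdeal F y)) =
      (N : ℝ)⁻¹ * (Module.finrank ℚ F * Real.log r.den) := by
    have h1 := congrArg Ideal.absNorm (denomIdeal_pow F y N)
    rw [h, denomIdeal_ratCast, Ideal.absNorm_span_natCast, map_pow, RingOfIntegers.rank] at h1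
    have h2 := congrArg (fun n : ℕ ↦ Real.log (n : ℝ)) h1
    simp only [Nat.cast_pow, Real.log_pow] at h2
    rw [h2]
    field_simp
  have hmult : ∑ w : InfinitePlace F, (w.mult : ℝ) = Module.finrank ℚ F := by
    exact_mod_cast InfinitePlace.sum_mult_eq (K := F)
  rw [nfHeight, hnorm]
  simp_rw [hplace]
  rw [← Finset.sum_mul, hmult]
  field_simp

theorem algHeight_of_pow_eq_ratCast {y : ℂ} {N : ℕ} (hN : N ≠ 0) {r : ℚ} (hr : 0 < r)
    (h : y ^ N = (r : ℂ)) :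
    algHeight y = (N : ℝ)⁻¹ * (Real.log (max 1 (r : ℝ)) + Real.log r.den) := by
  have hy : IsIntegral ℚ y := by
    apply IsIntegral.of_pow (Nat.pos_of_ne_zero hN)
    rw [h]
    exact isIntegral_algebraMap (R := ℚ) (x := r)
  rw [algHeight, dif_pos hy]
  have : FiniteDimensional ℚ ℚ⟮y⟯ := adjoin.finiteDimensional hy
  have : NumberField ℚ⟮y⟯ := ⟨⟩
  apply nfHeight_of_pow_eq_ratCast _ hN hr
  apply Subtype.ext
  simpa using h

theorem log_max_one_add_log_den {r : ℚ} (hr : 0 < r) :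
    Real.log (max 1 (r : ℝ)) + Real.log r.den = Real.log (max (r.num.natAbs : ℝ) r.den) := by
  have hd : (0 : ℝ) < r.den := by exact_mod_cast r.den_pos
  have hn : (r.num.natAbs : ℝ) = r * r.den := by
    have h1 : ((r.num.natAbs : ℤ) : ℝ) = (r.num : ℝ) := by
      rw [Int.natAbs_of_nonneg (Rat.num_pos.2 hr).le]
    have h2 : (r : ℝ) * r.den = r.num := by exact_mod_cast Rat.mul_den_eq_num r
    rw [h2, ← h1, Int.cast_natCast]
  rw [← Real.log_mul (by positivity) hd.ne', max_mul_of_nonneg _ _ hd.le, one_mul, hn, max_comm]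

theorem algHeight_ratCast {r : ℚ} (hr : 0 < r) :
    algHeight (r : ℂ) = Real.log (max (r.num.natAbs : ℝ) r.den) := by
  rw [algHeight_of_pow_eq_ratCast one_ne_zero hr (pow_one _), Nat.cast_one, inv_one, one_mul,
    log_max_one_add_log_den hr]

theorem algHeight_ratCast_pos {r : ℚ} (hr : 0 < r) (h1 : r ≠ 1) : 0 < algHeight (r : ℂ) := by
  rw [algHeight_ratCast hr]
  apply Real.log_pos
  by_contra! hle
  have hn : r.num.natAbs ≤ 1 := by exact_mod_cast (le_max_left _ _).trans hle
  have hd : r.den ≤ 1 := by exact_mod_cast (le_max_right _ _).trans hle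
  have hn0 := Rat.num_pos.2 hr
  have hd0 := r.den_pos
  apply h1
  rw [← Rat.num_div_den r, show r.num = 1 by omega, show r.den = 1 by omega]
  norm_num

theorem algHeight_ratCast_zpow {b : ℚ} (hb : 0 < b) (M : ℤ) :
    algHeight ((b ^ M : ℚ) : ℂ) = |(M : ℝ)| * algHeight (b : ℂ) := by
  have hpow (n : ℕ) : max (((b ^ n).num.natAbs : ℕ) : ℝ) (b ^ n).den =
      (max (b.num.natAbs : ℝ) b.den) ^ n := by
    rw [Rat.num_pow, Rat.den_pow, Int.natAbs_pow, Nat.cast_pow, Nat.cast_pow]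
    refine ((pow_left_monotoneOn (M₀ := ℝ) (n := n)).map_max ?_ ?_).symm
    · exact Set.mem_ofPred.2 (Nat.cast_nonneg (α := ℝ) b.num.natAbs)
    · exact Set.mem_ofPred.2 (Nat.cast_nonneg (α := ℝ) b.den)
  have hnat (n : ℕ) : algHeight ((b ^ n : ℚ) : ℂ) = n * algHeight (b : ℂ) := by
    rw [algHeight_ratCast (pow_pos hb n), hpow, Real.log_pow, algHeight_ratCast hb]
  have hinv {r : ℚ} (hr : 0 < r) : algHeight ((r⁻¹ : ℚ) : ℂ) = algHeight (r : ℂ) := by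
    rw [algHeight_ratCast hr, algHeight_ratCast (inv_pos.2 hr), Rat.den_inv_of_ne_zero hr.ne',
      Rat.num_inv, Int.sign_eq_one_of_pos (Rat.num_pos.2 hr), one_mul, Int.natAbs_natCast, max_comm]
  obtain ⟨n, rfl | rfl⟩ := M.eq_nat_or_neg
  · simpa using hnat n
  · rw [zpow_neg, hinv (zpow_pos hb _)]
    simpa using hnat n

/-- Rational powers of a positive rational number have proportional heights. -/
theorem algHeight_rpow_ratCast {b : ℚ} (hb : 0 < b) (s : ℚ) :
    algHeight ((((b : ℝ) ^ (s : ℝ) : ℝ) : ℂ)) = |(s : ℝ)| * algHeight (b : ℂ) := by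
  have hbR : (0 : ℝ) < b := by exact_mod_cast hb
  have hM : (0 : ℚ) < b ^ s.num := zpow_pos hb _
  have hd : (0 : ℝ) < s.den := by exact_mod_cast s.den_pos
  have h : ((((b : ℝ) ^ (s : ℝ) : ℝ) : ℂ)) ^ s.den = ((b ^ s.num : ℚ) : ℂ) := by
    have : ((b : ℝ) ^ (s : ℝ)) ^ s.den = ((b ^ s.num : ℚ) : ℝ) := by
      rw [← Real.rpow_mul_natCast hbR.le, show (s : ℝ) * s.den = (s.num : ℝ) by
        exact_mod_cast Rat.mul_den_eq_num s, Real.rpow_intCast, Rat.cast_zpow]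
    exact_mod_cast congrArg (fun t : ℝ ↦ (t : ℂ)) this
  have hs : (s : ℝ) = s.num / s.den := Rat.cast_def s
  rw [algHeight_of_pow_eq_ratCast s.den_nz hM h, log_max_one_add_log_den hM,
    ← algHeight_ratCast hM, algHeight_ratCast_zpow hb, hs, abs_div, abs_of_pos hd]
  field_simp

/-- A quadratic extension contains no new cube roots of elements of the base field. -/
theorem exists_pow_three_eq_of_mem_adjoin_sqrt {F E : Type*} [Field F] [Field E] [Algebra F E]
    {a v : F} {u c : E} (hu : u ^ 2 = algebraMap F E v) (hc : c ^ 3 = algebraMap F E a)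
    (hmem : c ∈ F⟮u⟯) : ∃ q : F, q ^ 3 = a := by
  have hu_int : IsIntegral F u := IsIntegral.of_pow two_pos (hu ▸ isIntegral_algebraMap)
  have : FiniteDimensional F F⟮u⟯ := adjoin.finiteDimensional hu_int
  have hle : Module.finrank F F⟮u⟯ ≤ 2 := by
    rw [adjoin.finrank hu_int, ← Polynomial.natDegree_X_pow_sub_C (n := 2) (r := v)]
    apply Polynomial.natDegree_le_of_dvd
    · exact minpoly.dvd _ _ (by simp [hu])
    · exact Polynomial.X_pow_sub_C_ne_zero two_pos v
  have hcop : Nat.Coprime (Module.finrank F F⟮u⟯) 3 := by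
    have := Module.finrank_pos (R := F) (M := F⟮u⟯)
    interval_cases Module.finrank F F⟮u⟯ <;> norm_num
  have hnorm : (Algebra.norm F (⟨c, hmem⟩ : F⟮u⟯)) ^ 3 = a ^ Module.finrank F F⟮u⟯ := by
    rw [← map_pow, ← Algebra.norm_algebraMap]
    congr 1
    exact Subtype.ext hc
  exact (pow_mem_range_pow_of_coprime hcop a).mp ⟨_, hnorm⟩

/-- Adjoining a `2 ^ n`-th root does not create new cube roots of elements of the base field. -/
theorem exists_pow_three_eq_of_mem_adjoin_two_pow_root.{u} {E : Type u} [Field E] (n : ℕ) :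
    ∀ {F : Type u} [Field F] [Algebra F E] {a v : F} {y c : E},
      y ^ 2 ^ n = algebraMap F E v → c ^ 3 = algebraMap F E a → c ∈ F⟮y⟯ → ∃ q : F, q ^ 3 = a := by
  induction n with
  | zero =>
    intro F _ _ a v y c hy hc hmem
    exact exists_pow_three_eq_of_mem_adjoin_sqrt (v := v ^ 2) (by simp_all) hc hmem
  | succ n ih =>
    intro F _ _ a v y c hy hc hmem
    set u := y ^ 2 ^ n with hu
    have hle : F⟮y⟯ ≤ (F⟮u⟯⟮y⟯).restrictScalars F := by
      rw [adjoin_simple_le_iff]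
      exact mem_adjoin_simple_self F⟮u⟯ y
    obtain ⟨q, hq⟩ := ih (F := F⟮u⟯) (a := algebraMap F F⟮u⟯ a) (v := AdjoinSimple.gen F u)
      (y := y) (c := c) hu.symm hc (hle hmem)
    refine exists_pow_three_eq_of_mem_adjoin_sqrt (v := v) (u := u) (c := (q : E)) ?_ ?_ q.2
    · rw [hu, ← pow_mul, ← pow_succ, hy]
    · exact congrArg (algebraMap F⟮u⟯ E) hq

end RelBogomolov

/-- Example: for `K = ⋃_n ℚ(b^{1/2^n})` (positive real roots, `b` a positive rational which is
neither a square nor a cube), the cube root `b^{1/3} ∉ K` and `K(b^{1/3})/K` is not Bogomolov: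
the elements `b^{1/3}·b^x` for rational `x` with `2`-power denominator have positive height
`|x + 1/3|·h(b)`, which tends to `0` as `x → -1/3`. -/
theorem not_bogomolovExtension_adjoin_cubeRoot
    (b : ℚ) (hb : 0 < b) (hb2 : ¬∃ q : ℚ, q ^ 2 = b) (hb3 : ¬∃ q : ℚ, q ^ 3 = b)
    (K : IntermediateField ℚ ℂ)
    (hK : K = ⨆ n : ℕ, ℚ⟮((((b : ℝ) ^ (((2 : ℝ) ^ (n + 1 : ℕ))⁻¹) : ℝ) : ℂ))⟯)
    (c : ℂ) (hc : c = (((b : ℝ) ^ ((3 : ℝ)⁻¹) : ℝ) : ℂ))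
    (L : IntermediateField ℚ ℂ) (hL : L = K ⊔ ℚ⟮c⟯) :
    c ∉ K ∧ ¬ IsBogomolovExtension K L ∧
      ∀ x : ℚ, (∃ m : ℕ, x.den = 2 ^ m) → x ≠ -(1/3) →
        c * (((b : ℝ) ^ (x : ℝ) : ℝ) : ℂ) ∈ L ∧
        c * (((b : ℝ) ^ (x : ℝ) : ℝ) : ℂ) ∉ K ∧
        0 < algHeight (c * (((b : ℝ) ^ (x : ℝ) : ℝ) : ℂ)) ∧
        algHeight (c * (((b : ℝ) ^ (x : ℝ) : ℝ) : ℂ)) = |(x : ℝ) + 1/3| * algHeight (b : ℂ) := by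
  have hbR : (0 : ℝ) < b := by exact_mod_cast hb
  have hb1 : b ≠ 1 := fun h ↦ hb2 ⟨1, by rw [h, one_pow]⟩
  have hc3 : c ^ 3 = algebraMap ℚ ℂ b := by
    have h3 : ((b : ℝ) ^ ((3 : ℝ)⁻¹)) ^ 3 = b := by
      rw [← Real.rpow_mul_natCast hbR.le]
      norm_num
    rw [hc, eq_ratCast]
    exact_mod_cast congrArg (fun t : ℝ ↦ (t : ℂ)) h3
  set y : ℕ → ℝ := fun n ↦ (b : ℝ) ^ (((2 : ℝ) ^ (n + 1 : ℕ))⁻¹) with hy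
  have hy_pow (n k : ℕ) : y (n + k) ^ 2 ^ k = y n := by
    simp only [hy]
    rw [← Real.rpow_mul_natCast hbR.le]
    congr 1
    push_cast
    field_simp
    ring
  have hmono : Monotone fun n ↦ ℚ⟮(y n : ℂ)⟯ := by
    intro n m hnm
    obtain ⟨k, rfl⟩ := Nat.exists_eq_add_of_le hnm
    rw [adjoin_simple_le_iff, ← hy_pow n k, Complex.ofReal_pow]
    exact pow_mem (mem_adjoin_simple_self ℚ _) _
  have hcK : c ∉ K := by
    intro h
    rw [hK, ← SetLike.mem_coe, coe_iSup_of_directed hmono.directed_le, Set.mem_iUnion] at h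
    obtain ⟨n, hn⟩ := h
    refine hb3 (exists_pow_three_eq_of_mem_adjoin_two_pow_root (n + 1) (v := b) ?_ hc3 hn)
    have : y n ^ 2 ^ (n + 1) = b := by
      simp only [hy]
      rw [← Real.rpow_mul_natCast hbR.le]
      push_cast
      rw [inv_mul_cancel₀ (by positivity), Real.rpow_one]
    rw [eq_ratCast]
    exact_mod_cast congrArg (fun t : ℝ ↦ (t : ℂ)) this
  have key : ∀ x : ℚ, (∃ m : ℕ, x.den = 2 ^ m) → x ≠ -(1/3) →
      c * (((b : ℝ) ^ (x : ℝ) : ℝ) : ℂ) ∈ L ∧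
      c * (((b : ℝ) ^ (x : ℝ) : ℝ) : ℂ) ∉ K ∧
      0 < algHeight (c * (((b : ℝ) ^ (x : ℝ) : ℝ) : ℂ)) ∧
      algHeight (c * (((b : ℝ) ^ (x : ℝ) : ℝ) : ℂ)) = |(x : ℝ) + 1/3| * algHeight (b : ℂ) := by
    rintro x ⟨m, hm⟩ hx
    have hxK : (((b : ℝ) ^ (x : ℝ) : ℝ) : ℂ) ∈ K := by
      have : (b : ℝ) ^ (x : ℝ) = y m ^ (2 * x.num) := by
        simp only [hy]
        rw [← Real.rpow_intCast, ← Real.rpow_mul hbR.le, Rat.cast_def x, hm]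
        congr 1
        push_cast
        field_simp
        ring
      rw [this, Complex.ofReal_zpow, hK]
      exact zpow_mem (le_iSup (fun n ↦ ℚ⟮(y n : ℂ)⟯) m (mem_adjoin_simple_self ℚ _)) _
    have hx0 : (((b : ℝ) ^ (x : ℝ) : ℝ) : ℂ) ≠ 0 := by
      exact_mod_cast (Real.rpow_pos_of_pos hbR _).ne'
    have hheight : algHeight (c * (((b : ℝ) ^ (x : ℝ) : ℝ) : ℂ)) =
        |(x : ℝ) + 1/3| * algHeight (b : ℂ) := by
      have := algHeight_rpow_ratCast hb (x + 1/3)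
      push_cast at this
      rw [← this, hc, ← Complex.ofReal_mul, ← Real.rpow_add hbR, add_comm, one_div]
    refine ⟨?_, ?_, ?_, hheight⟩
    · rw [hL]
      exact mul_mem ((le_sup_right : ℚ⟮c⟯ ≤ K ⊔ ℚ⟮c⟯) (mem_adjoin_simple_self ℚ c))
        ((le_sup_left : K ≤ K ⊔ ℚ⟮c⟯) hxK)
    · intro h
      apply hcK
      have := div_mem h hxK
      rwa [mul_div_cancel_right₀ _ hx0] at this
    · rw [hheight]
      refine mul_pos (abs_pos.2 fun h ↦ hx ?_) (algHeight_ratCast_pos hb hb1)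
      have : (x : ℝ) = ((-(1/3) : ℚ) : ℝ) := by
        push_cast
        linarith
      exact_mod_cast this
  refine ⟨hcK, ?_, key⟩
  rintro ⟨ε, hε, hbog⟩
  obtain ⟨m, hm⟩ := pow_unbounded_of_one_lt (algHeight (b : ℂ) / ε) (one_lt_two (α := ℝ))
  set x : ℚ := (⌊-(2 ^ m : ℚ) / 3⌋ : ℚ) / ((2 ^ m : ℕ) : ℚ) with hxdef
  have hden : ∃ k : ℕ, x.den = 2 ^ k := by
    have hdvd : x.den ∣ 2 ^ m := by
      have := Rat.den_dvd ⌊-(2 ^ m : ℚ) / 3⌋ ((2 ^ m : ℕ) : ℤ)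
      rw [Rat.divInt_eq_div, Int.cast_natCast] at this
      exact Int.natCast_dvd_natCast.1 this
    obtain ⟨k, -, hk⟩ := (Nat.dvd_prime_pow Nat.prime_two).1 hdvd
    exact ⟨k, hk⟩
  have hx3 : x ≠ -(1/3) := by
    intro h
    obtain ⟨k, hk⟩ := hden
    have h3 : x.den = 3 := by rw [h]; norm_num
    have : 3 ∣ 2 ^ k := by rw [← hk, h3]
    have := Nat.prime_three.dvd_of_dvd_pow this
    omega
  obtain ⟨hxL, hxK, hpos, hheight⟩ := key x hden hx3
  refine hxK (hbog _ hxL ?_ hpos ?_)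
  · intro h
    exact hxK (h ▸ zero_mem K)
  · have hclose : |x + 1/3| ≤ 1 / 2 ^ m := by
      have h1 := Int.floor_le (-(2 ^ m : ℚ) / 3)
      have h2 := Int.lt_floor_add_one (-(2 ^ m : ℚ) / 3)
      have h2m : (0 : ℚ) < 2 ^ m := by positivity
      have : x + 1/3 = ((⌊-(2 ^ m : ℚ) / 3⌋ : ℚ) - -(2 ^ m : ℚ) / 3) / 2 ^ m := by
        rw [hxdef]
        push_cast
        field_simp
        ring
      rw [this, abs_div, abs_of_pos h2m]
      gcongr
      rw [abs_le]
      constructor <;> linarith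
    have hcloseR : |(x : ℝ) + 1/3| ≤ 1 / 2 ^ m := by
      have := (Rat.cast_le (K := ℝ)).2 hclose
      push_cast at this
      exact this
    have hh := algHeight_ratCast_pos hb hb1
    rw [hheight]
    calc |(x : ℝ) + 1/3| * algHeight (b : ℂ) ≤ 1 / 2 ^ m * algHeight (b : ℂ) := by gcongr
      _ < ε := by
        rw [div_lt_iff₀ hε] at hm
        rw [one_div, inv_mul_lt_iff₀ (by positivity)]
        exact hm
end
end
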